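/- Equivalence of the base-point norms: Let b be a connected graph over X and q : X → ℝ a potential such that h ≥ 0. Then for all o, o' ∈ X there exists a constant C > 0 such that h(φ) + φ(o)² ≤ C·(h(φ) + φ(o')²) for all φ ∈ C_c(X). In particular, for every o ∈ X and every x ∈ X there is C_x > 0 with φ(x)² ≤ C_x·(h(φ) + φ(o)²) for all φ ∈ C_c(X), so that convergence with respect to the norm (h(·) + (·)(o)²)^{1/2} implies pointwise convergence. -/

import Mathlib

open Filter Topology

variable {X : Type*}

/-- A graph over `X`: symmetric, nonnegative, zero diagonal, locally summable. -/
def IsGraph (b : X → X → ℝ) : Prop :=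
  (∀ x y, 0 ≤ b x y) ∧ (∀ x y, b x y = b y x) ∧ (∀ x, b x x = 0) ∧
    ∀ x, Summable fun y => b x y

/-- Connectedness of the graph `b`: any two vertices are joined by a path of
adjacent vertices. -/
def GraphConnected (b : X → X → ℝ) : Prop :=
  ∀ x y : X, ∃ (n : ℕ) (p : ℕ → X), p 0 = x ∧ p n = y ∧ ∀ i < n, 0 < b (p i) (p (i + 1))

/-- A set `W` is connected in the graph `b` if any two of its points are joined by a
path of adjacent vertices lying in `W`. -/
def ConnectedIn (b : X → X → ℝ) (W : Set X) : Prop :=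
  ∀ x ∈ W, ∀ y ∈ W, ∃ (n : ℕ) (p : ℕ → X), p 0 = x ∧ p n = y ∧
    (∀ i ≤ n, p i ∈ W) ∧ ∀ i < n, 0 < b (p i) (p (i + 1))

/-- Local finiteness of the graph `b`. -/
def LocFin (b : X → X → ℝ) : Prop := ∀ x, {y | 0 < b x y}.Finite

/-- Membership in `F(X)`, the functions against which `b` is summable. -/
def MemF (b : X → X → ℝ) (f : X → ℝ) : Prop :=
  ∀ x, Summable fun y => b x y * |f y|

/-- The formal Schrödinger operator `H = L + q`. -/
noncomputable def Hop (b : X → X → ℝ) (q : X → ℝ) (f : X → ℝ) (x : X) : ℝ :=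
  (∑' y, b x y * (f x - f y)) + q x * f x

/-- Membership in `C_c(X)`: finitely supported functions. -/
def FinSupp (φ : X → ℝ) : Prop := (Function.support φ).Finite

/-- The energy form `h` associated with `b` and `q`, evaluated on `C_c(X)`. -/
noncomputable def hform (b : X → X → ℝ) (q : X → ℝ) (φ : X → ℝ) : ℝ :=
  (1 / 2) * (∑' p : X × X, b p.1 p.2 * (φ p.1 - φ p.2) ^ 2) + ∑' x, q x * φ x ^ 2

/-- The form `h` is subcritical in `X`. -/
def Subcritical (b : X → X → ℝ) (q : X → ℝ) : Prop :=
  ∃ w : X → ℝ, (∀ x, 0 ≤ w x) ∧ w ≠ 0 ∧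
    ∀ φ : X → ℝ, FinSupp φ → (∑' x, w x * φ x ^ 2) ≤ hform b q φ

/-- The capacity of the singleton `{x}` with respect to the form `h`. -/
noncomputable def capH (b : X → X → ℝ) (q : X → ℝ) (x : X) : ℝ :=
  sInf {r : ℝ | ∃ φ : X → ℝ, FinSupp φ ∧ φ x = 1 ∧ r = hform b q φ}

/-- The extended (extended-real-valued) energy of the weighted Laplacian part. -/
noncomputable def hExt (b : X → X → ℝ) (f : X → ℝ) : ENNReal :=
  (∑' p : X × X, ENNReal.ofReal (b p.1 p.2 * (f p.1 - f p.2) ^ 2)) / 2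

/-- A family supported on the row `{y} × X` sums to the sum over that row. -/
theorem hasSum_prod_row {g : X × X → ℝ} {y : X} {s : ℝ}
    (hs : HasSum (fun z => g (y, z)) s) (h0 : ∀ p : X × X, p.1 ≠ y → g p = 0) : HasSum g s := by
  have hinj : Function.Injective (Prod.mk y : X → X × X) := Prod.mk_right_injective y
  refine (hinj.hasSum_iff ?_).1 hs
  rintro ⟨a, c⟩ hp
  apply h0
  rintro rfl
  exact hp ⟨c, rfl⟩

theorem IsGraph.summable_mul_fst {b : X → X → ℝ} (hb : IsGraph b) {f : X → ℝ} (hf : FinSupp f) :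
    Summable fun p : X × X => b p.1 p.2 * f p.1 := by
  classical
  have key : (fun p : X × X => b p.1 p.2 * f p.1) =
      fun p => ∑ x ∈ hf.toFinset, (if p.1 = x then b p.1 p.2 * f p.1 else 0) := by
    funext p
    rw [Finset.sum_ite_eq]
    split_ifs with h
    · rfl
    · have : f p.1 = 0 := by_contra fun hne => h ((Set.Finite.mem_toFinset hf).2 hne)
      simp [this]
  rw [key]
  refine summable_sum fun x _ => ?_
  have hs : Summable fun z => b x z * f x := (hb.2.2.2 x).mul_right _
  refine (hasSum_prod_row (y := x) (s := ∑' z, b x z * f x) ?_ ?_).summable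
  · simpa using hs.hasSum
  · intro p hp
    simp [hp]

theorem IsGraph.summable_mul_snd {b : X → X → ℝ} (hb : IsGraph b) {f : X → ℝ} (hf : FinSupp f) :
    Summable fun p : X × X => b p.1 p.2 * f p.2 := by
  have h := (Equiv.prodComm X X).summable_iff.2 (hb.summable_mul_fst hf)
  refine h.congr fun p => ?_
  simp [hb.2.1 p.2 p.1]

theorem FinSupp.mul_left {φ : X → ℝ} (hφ : FinSupp φ) (g : X → ℝ) :
    FinSupp fun x => g x * φ x :=
  Set.Finite.subset hφ fun _ hx => right_ne_zero_of_mul hx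

theorem FinSupp.sq {φ : X → ℝ} (hφ : FinSupp φ) : FinSupp fun x => φ x ^ 2 :=
  Set.Finite.subset hφ fun x hx => by
    simpa using hx

theorem FinSupp.abs {φ : X → ℝ} (hφ : FinSupp φ) : FinSupp fun x => |φ x| :=
  Set.Finite.subset hφ fun x hx => by
    simpa using hx

theorem FinSupp.summable {φ : X → ℝ} (hφ : FinSupp φ) : Summable φ :=
  summable_of_hasFiniteSupport hφ

theorem IsGraph.summable_energy {b : X → X → ℝ} (hb : IsGraph b) {φ : X → ℝ} (hφ : FinSupp φ) :
    Summable fun p : X × X => b p.1 p.2 * (φ p.1 - φ p.2) ^ 2 := by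
  have h := ((hb.summable_mul_fst hφ.sq).add (hb.summable_mul_snd hφ.sq)).mul_left 2
  refine Summable.of_nonneg_of_le (fun p => mul_nonneg (hb.1 _ _) (sq_nonneg _)) (fun p => ?_) h
  nlinarith [mul_nonneg (hb.1 p.1 p.2) (sq_nonneg (φ p.1 + φ p.2))]

theorem IsGraph.summable_laplacian {b : X → X → ℝ} (hb : IsGraph b) {φ : X → ℝ}
    (hφ : FinSupp φ) (y : X) : Summable fun z => b y z * (φ y - φ z) := by
  refine (((hb.2.2.2 y).mul_right (φ y)).sub (hφ.mul_left (b y)).summable).congr fun z => ?_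
  ring

theorem hform_abs_le {b : X → X → ℝ} (q : X → ℝ) (hb : IsGraph b) {φ : X → ℝ} (hφ : FinSupp φ) :
    hform b q (fun x => |φ x|) ≤ hform b q φ := by
  unfold hform
  simp only [sq_abs]
  gcongr ?_ * ?_ + _
  refine (hb.summable_energy hφ.abs).tsum_le_tsum (fun p => ?_) (hb.summable_energy hφ)
  exact mul_le_mul_of_nonneg_left (sq_le_sq.2 (abs_abs_sub_abs_le _ _)) (hb.1 _ _)

theorem finSupp_single [DecidableEq X] (y : X) : FinSupp (Pi.single y 1 : X → ℝ) :=
  (Set.finite_singleton y).subset Pi.support_single_subset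

/-- Expansion of the energy form along the direction of the indicator of `y`; the linear
coefficient is the formal Schrödinger operator at `y`. -/
theorem hform_add_single [DecidableEq X] {b : X → X → ℝ} (q : X → ℝ) (hb : IsGraph b)
    {φ : X → ℝ} (hφ : FinSupp φ) (y : X) (t : ℝ) :
    hform b q (fun x => φ x + t * (Pi.single y 1 : X → ℝ) x) =
      hform b q φ + 2 * t * Hop b q φ y + t ^ 2 * hform b q (Pi.single y 1) := by
  set e : X → ℝ := Pi.single y 1 with he
  have hfe : FinSupp e := finSupp_single y
  have hey : e y = 1 := Pi.single_eq_same y 1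
  have hen : ∀ x, x ≠ y → e x = 0 := fun x hx => Pi.single_eq_of_ne hx 1
  have hrow : HasSum (fun p : X × X => b p.1 p.2 * (φ p.1 - φ p.2) * e p.1)
      (∑' z, b y z * (φ y - φ z)) := by
    refine hasSum_prod_row (y := y) ?_ fun p hp => by simp [hen _ hp]
    simpa [hey] using (hb.summable_laplacian hφ y).hasSum
  have hcol := (Equiv.prodComm X X).hasSum_iff.2 hrow
  have hcross := (hrow.add hcol).mul_left (2 * t)
  have hen1 := ((hb.summable_energy hφ).hasSum.add hcross).add
    ((hb.summable_energy hfe).hasSum.mul_left (t ^ 2))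
  have hen2 : HasSum (fun x => q x * φ x * e x) (q y * φ y) := by
    have h := hasSum_single (f := fun x => q x * φ x * e x) y fun x hx => by simp [hen x hx]
    simpa [hey] using h
  have hpot := (((hφ.sq.mul_left q).summable.hasSum).add (hen2.mul_left (2 * t))).add
    ((hfe.sq.mul_left q).summable.hasSum.mul_left (t ^ 2))
  have h1 := hen1.tsum_eq
  have h2 := hpot.tsum_eq
  unfold hform Hop
  rw [show (fun x => q x * (φ x + t * e x) ^ 2) = fun x =>
      q x * φ x ^ 2 + 2 * t * (q x * φ x * e x) + t ^ 2 * (q x * e x ^ 2) by funext x; ring, h2,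
    show (fun p : X × X => b p.1 p.2 * (φ p.1 + t * e p.1 - (φ p.2 + t * e p.2)) ^ 2) = fun p =>
      b p.1 p.2 * (φ p.1 - φ p.2) ^ 2 +
        2 * t * (b p.1 p.2 * (φ p.1 - φ p.2) * e p.1 +
          ((fun p : X × X => b p.1 p.2 * (φ p.1 - φ p.2) * e p.1) ∘ Equiv.prodComm X X) p) +
        t ^ 2 * (b p.1 p.2 * (e p.1 - e p.2) ^ 2) by
      funext p
      simp only [Function.comp, Equiv.prodComm_apply, Prod.fst_swap, Prod.snd_swap, hb.2.1 p.2 p.1]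
      ring, h1]
  ring

/-- Cauchy–Schwarz inequality for the energy form, tested against the indicator of `y`. -/
theorem Hop_sq_le [DecidableEq X] {b : X → X → ℝ} {q : X → ℝ} (hb : IsGraph b)
    (hpos : ∀ φ : X → ℝ, FinSupp φ → 0 ≤ hform b q φ) {φ : X → ℝ} (hφ : FinSupp φ) (y : X) :
    Hop b q φ y ^ 2 ≤ hform b q (Pi.single y 1) * hform b q φ := by
  have h : discrim (hform b q (Pi.single y 1)) (2 * Hop b q φ y) (hform b q φ) ≤ 0 := by
    refine discrim_le_zero fun t => ?_
    have hfin : FinSupp fun x => φ x + t * (Pi.single y 1 : X → ℝ) x :=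
      (hφ.union (finSupp_single y)).subset fun x hx => by
        by_contra hn
        simp only [Set.mem_union, Function.mem_support, not_or, not_not] at hn
        exact hx (by simp [hn.1, hn.2])
    have := hpos _ hfin
    rw [hform_add_single q hb hφ] at this
    linarith
  unfold discrim at h
  linarith

theorem Hop_le_of_nonneg {b : X → X → ℝ} (q : X → ℝ) (hb : IsGraph b) {φ : X → ℝ}
    (hφ : FinSupp φ) (h0 : ∀ x, 0 ≤ φ x) (x y : X) :
    Hop b q φ y ≤ ((∑' z, b y z) + q y) * φ y - b y x * φ x := by
  have h1 := (hφ.mul_left (b y)).summable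
  have h2 : b y x * φ x ≤ ∑' z, b y z * φ z :=
    h1.le_tsum x fun z _ => mul_nonneg (hb.1 _ _) (h0 z)
  have h3 : ∑' z, b y z * (φ y - φ z) = (∑' z, b y z) * φ y - ∑' z, b y z * φ z := by
    rw [← tsum_mul_right, ← ((hb.2.2.2 y).mul_right (φ y)).tsum_sub h1]
    exact tsum_congr fun z => by ring
  unfold Hop
  rw [h3]
  linarith

/-- `φ x` is controlled by the base-point norm at an adjacent vertex `y`. -/
theorem exists_sq_le_of_adj {b : X → X → ℝ} {q : X → ℝ} (hb : IsGraph b)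
    (hpos : ∀ φ : X → ℝ, FinSupp φ → 0 ≤ hform b q φ) {x y : X} (hxy : 0 < b x y) :
    ∃ C : ℝ, 0 ≤ C ∧ ∀ φ : X → ℝ, FinSupp φ → φ x ^ 2 ≤ C * (hform b q φ + φ y ^ 2) := by
  classical
  set D := (∑' z, b y z) + q y
  set E := hform b q (Pi.single y 1)
  have hE : 0 ≤ E := hpos _ (finSupp_single y)
  have hβ : 0 < b y x := hb.2.1 x y ▸ hxy
  refine ⟨2 * (D ^ 2 + E) / b y x ^ 2, by positivity, fun φ hφ => ?_⟩
  have hcs := Hop_sq_le hb hpos hφ.abs y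
  have hle := Hop_le_of_nonneg q hb hφ.abs (fun z => abs_nonneg (φ z)) x y
  have habs := mul_le_mul_of_nonneg_left (hform_abs_le q hb hφ) hE
  set B := Hop b q (fun z => |φ z|) y
  have hsq : (b y x * |φ x|) ^ 2 ≤ (D * |φ y| - B) ^ 2 :=
    pow_le_pow_left₀ (by positivity) (by linarith) 2
  have hsq' : b y x ^ 2 * φ x ^ 2 ≤ (D * |φ y| - B) ^ 2 := by
    rwa [mul_pow, sq_abs] at hsq
  have hexp : (D * |φ y| - B) ^ 2 ≤ 2 * (D ^ 2 * φ y ^ 2) + 2 * B ^ 2 := by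
    rw [← sq_abs (φ y)]
    nlinarith [sq_nonneg (D * |φ y| + B)]
  have h1 : 0 ≤ D ^ 2 * hform b q φ := mul_nonneg (sq_nonneg _) (hpos φ hφ)
  have h2 : 0 ≤ E * φ y ^ 2 := mul_nonneg hE (sq_nonneg _)
  rw [div_mul_eq_mul_div, le_div_iff₀ (by positivity)]
  linarith

theorem exists_hform_add_sq_le_of_path {b : X → X → ℝ} {q : X → ℝ} (hb : IsGraph b)
    (hpos : ∀ φ : X → ℝ, FinSupp φ → 0 ≤ hform b q φ) (p : ℕ → X) (n : ℕ)
    (hp : ∀ i < n, 0 < b (p i) (p (i + 1))) :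
    ∃ C : ℝ, 0 < C ∧ ∀ φ : X → ℝ, FinSupp φ →
      hform b q φ + φ (p 0) ^ 2 ≤ C * (hform b q φ + φ (p n) ^ 2) := by
  induction n with
  | zero => exact ⟨1, one_pos, fun φ _ => by rw [one_mul]⟩
  | succ n ih =>
    obtain ⟨C, hC, h⟩ := ih fun i hi => hp i (by omega)
    obtain ⟨K, hK, h'⟩ := exists_sq_le_of_adj hb hpos (hp n n.lt_succ_self)
    refine ⟨C * (1 + K), by positivity, fun φ hφ => (h φ hφ).trans ?_⟩
    rw [mul_assoc]
    refine mul_le_mul_of_nonneg_left ?_ hC.le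
    linarith [h' φ hφ, sq_nonneg (φ (p (n + 1)))]

/-- Equivalence of the base-point norms, and pointwise control by the norm. -/
theorem basepoint_norm_equivalence (b : X → X → ℝ) (q : X → ℝ) (hb : IsGraph b)
    (hconn : GraphConnected b)
    (hpos : ∀ φ : X → ℝ, FinSupp φ → 0 ≤ hform b q φ) :
    (∀ o o' : X, ∃ C : ℝ, 0 < C ∧ ∀ φ : X → ℝ, FinSupp φ →
      hform b q φ + φ o ^ 2 ≤ C * (hform b q φ + φ o' ^ 2)) ∧
    ∀ o x : X, ∃ C : ℝ, 0 < C ∧ ∀ φ : X → ℝ, FinSupp φ →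
      φ x ^ 2 ≤ C * (hform b q φ + φ o ^ 2) := by
  have key : ∀ o o' : X, ∃ C : ℝ, 0 < C ∧ ∀ φ : X → ℝ, FinSupp φ →
      hform b q φ + φ o ^ 2 ≤ C * (hform b q φ + φ o' ^ 2) := by
    intro o o'
    obtain ⟨n, p, rfl, rfl, hp⟩ := hconn o o'
    exact exists_hform_add_sq_le_of_path hb hpos p n hp
  refine ⟨key, fun o x => ?_⟩
  obtain ⟨C, hC, h⟩ := key x o
  exact ⟨C, hC, fun φ hφ => by linarith [h φ hφ, hpos φ hφ]⟩
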